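/- The value function V is a viscosity subsolution of the Hamilton–Jacobi–Bellman equation V_t(t,x) + sup_{u∈U} ( ⟨V_x(t,x), f(x,u)⟩ − L(x,u,t) ) = 0 on (0,T) × ℝⁿ: for every C¹ test function φ on (0,T) × ℝⁿ and every point (t₀,x₀) at which V − φ attains a local maximum, one has φ_t(t₀,x₀) + H(x₀, φ_x(t₀,x₀), t₀) ≤ 0, where H(x,p,t) = sup_{u∈U} ( ⟨p, f(x,u)⟩ − L(x,u,t) ). -/

import Mathlib

open MeasureTheory Set
open scoped RealInnerProductSpace

noncomputable section

/-- Euclidean state space `ℝⁿ`. -/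
abbrev En (n : ℕ) := EuclideanSpace ℝ (Fin n)

/-- An admissible control–trajectory pair on `[a,b]`. -/
def IsAdmissible {n m : ℕ} (f : En n → En m → En n) (U : Set (En m)) (a b : ℝ)
    (u : ℝ → En m) (γ : ℝ → En n) : Prop :=
  Measurable u ∧ (∀ s ∈ Icc a b, u s ∈ U) ∧ ContinuousOn γ (Icc a b) ∧
    ∀ s ∈ Icc a b, γ s = γ a + ∫ r in a..s, f (γ r) (u r)

/-- The value function of the Bolza problem. -/
def valueFun {n m : ℕ} (f : En n → En m → En n) (U : Set (En m))
    (L : En n → En m → ℝ → ℝ) (I : En n → ℝ) (t : ℝ) (x : En n) : ℝ :=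
  sInf { J | ∃ u γ, IsAdmissible f U 0 t u γ ∧ γ t = x ∧
      J = (∫ s in (0:ℝ)..t, L (γ s) (u s) s) + I (γ 0) }

/-- The Hamiltonian `H(x,p,t) = sup_{u ∈ U} (⟨p, f(x,u)⟩ - L(x,u,t))`. -/
def ham {n m : ℕ} (f : En n → En m → En n) (U : Set (En m))
    (L : En n → En m → ℝ → ℝ) (x p : En n) (t : ℝ) : ℝ :=
  sSup { r | ∃ u ∈ U, r = ⟪p, f x u⟫ - L x u t }

section AdmissiblePairs

variable {n m : ℕ} {f : En n → En m → En n} {U : Set (En m)} {a b c : ℝ}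

lemma intervalIntegrable_comp_of_isCompact {E : Type*} [NormedAddCommGroup E]
    {G : En n → En m → ℝ → E} (hG : Continuous fun p : En n × En m × ℝ => G p.1 p.2.1 p.2.2)
    (hU : IsCompact U) {u : ℝ → En m} {γ : ℝ → En n} (hab : a ≤ b) (hu : Measurable u)
    (huU : ∀ s ∈ Icc a b, u s ∈ U) (hγ : ContinuousOn γ (Icc a b)) :
    IntervalIntegrable (fun r => G (γ r) (u r) r) volume a b := by
  rw [intervalIntegrable_iff_integrableOn_Icc_of_le hab]
  have hK : IsCompact ((γ '' Icc a b) ×ˢ (U ×ˢ Icc a b)) :=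
    (isCompact_Icc.image_of_continuousOn hγ).prod (hU.prod isCompact_Icc)
  obtain ⟨C, hC⟩ := hK.exists_bound_of_continuousOn hG.continuousOn
  refine Integrable.of_bound (C := C) ?_ ?_
  · have h1 : AEStronglyMeasurable γ (volume.restrict (Icc a b)) :=
      hγ.aestronglyMeasurable measurableSet_Icc
    have h2 : AEStronglyMeasurable u (volume.restrict (Icc a b)) := hu.aestronglyMeasurable
    have h3 : AEStronglyMeasurable (fun r : ℝ => r) (volume.restrict (Icc a b)) :=
      measurable_id.aestronglyMeasurable
    exact hG.comp_aestronglyMeasurable (h1.prodMk (h2.prodMk h3))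
  · filter_upwards [ae_restrict_mem measurableSet_Icc] with r hr
    exact hC (γ r, u r, r) ⟨mem_image_of_mem γ hr, huU r hr, hr⟩

lemma intervalIntegral_congr_Ioc {E : Type*} [NormedAddCommGroup E] [NormedSpace ℝ E]
    {g h : ℝ → E} (hab : a ≤ b) (hgh : EqOn g h (Ioc a b)) :
    ∫ r in a..b, g r = ∫ r in a..b, h r := by
  rw [intervalIntegral.integral_of_le hab, intervalIntegral.integral_of_le hab]
  exact setIntegral_congr_fun measurableSet_Ioc hgh

namespace IsAdmissible

variable {u u₁ u₂ : ℝ → En m} {γ γ₁ γ₂ : ℝ → En n}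

lemma intervalIntegrable {E : Type*} [NormedAddCommGroup E]
    {G : En n → En m → ℝ → E} (h : IsAdmissible f U a b u γ) (hab : a ≤ b) (hU : IsCompact U)
    (hG : Continuous fun p : En n × En m × ℝ => G p.1 p.2.1 p.2.2) :
    IntervalIntegrable (fun r => G (γ r) (u r) r) volume a b :=
  intervalIntegrable_comp_of_isCompact hG hU hab h.1 h.2.1 h.2.2.1

lemma intervalIntegrable_field (h : IsAdmissible f U a b u γ) (hab : a ≤ b) (hU : IsCompact U)
    (hf : Continuous fun p : En n × En m => f p.1 p.2) :
    IntervalIntegrable (fun r => f (γ r) (u r)) volume a b :=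
  h.intervalIntegrable (G := fun x v _ => f x v) hab hU
    (hf.comp (continuous_fst.prodMk continuous_snd.fst))

lemma eq_add_integral (h : IsAdmissible f U a b u γ) (hU : IsCompact U)
    (hf : Continuous fun p : En n × En m => f p.1 p.2) {s t : ℝ} (has : a ≤ s) (hst : s ≤ t)
    (htb : t ≤ b) : γ t = γ s + ∫ r in s..t, f (γ r) (u r) := by
  have hi := h.intervalIntegrable_field (has.trans (hst.trans htb)) hU hf
  rw [h.2.2.2 t ⟨has.trans hst, htb⟩, h.2.2.2 s ⟨has, hst.trans htb⟩, add_assoc,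
    intervalIntegral.integral_add_adjacent_intervals]
  · exact hi.mono_set (by
      rw [uIcc_of_le has, uIcc_of_le (has.trans (hst.trans htb))]
      exact Icc_subset_Icc le_rfl (hst.trans htb))
  · exact hi.mono_set (by
      rw [uIcc_of_le hst, uIcc_of_le (has.trans (hst.trans htb))]
      exact Icc_subset_Icc has htb)

lemma restrict (h : IsAdmissible f U a b u γ) (hU : IsCompact U)
    (hf : Continuous fun p : En n × En m => f p.1 p.2) {s t : ℝ} (has : a ≤ s)
    (htb : t ≤ b) : IsAdmissible f U s t u γ :=
  ⟨h.1, fun r hr => h.2.1 r (Icc_subset_Icc has htb hr), h.2.2.1.mono (Icc_subset_Icc has htb),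
    fun _ hr => h.eq_add_integral hU hf has hr.1 (hr.2.trans htb)⟩

lemma concat (h₁ : IsAdmissible f U a b u₁ γ₁) (h₂ : IsAdmissible f U b c u₂ γ₂)
    (hU : IsCompact U) (hf : Continuous fun p : En n × En m => f p.1 p.2)
    (hab : a ≤ b) (hbc : b ≤ c) (hγ : γ₁ b = γ₂ b) :
    IsAdmissible f U a c (fun s => if s ≤ b then u₁ s else u₂ s)
      (fun s => if s ≤ b then γ₁ s else γ₂ s) := by
  have e₂ : EqOn (fun s => if s ≤ b then γ₁ s else γ₂ s) γ₂ (Icc b c) := by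
    intro s hs
    rcases hs.1.eq_or_lt with rfl | hlt
    · simp [hγ]
    · simp [not_le.2 hlt]
  have e₁ : EqOn (fun s => if s ≤ b then γ₁ s else γ₂ s) γ₁ (Icc a b) :=
    fun s hs => if_pos hs.2
  have i₁ : ∀ s ∈ Icc a b, ∫ r in a..s, f (if r ≤ b then γ₁ r else γ₂ r)
      (if r ≤ b then u₁ r else u₂ r) = ∫ r in a..s, f (γ₁ r) (u₁ r) := fun s hs =>
    intervalIntegral_congr_Ioc hs.1 fun r hr => by simp [hr.2.trans hs.2]
  have i₂ : ∀ s ∈ Icc b c, ∫ r in b..s, f (if r ≤ b then γ₁ r else γ₂ r)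
      (if r ≤ b then u₁ r else u₂ r) = ∫ r in b..s, f (γ₂ r) (u₂ r) := fun s hs =>
    intervalIntegral_congr_Ioc hs.1 fun r hr => by simp [not_le.2 hr.1]
  have hu : Measurable fun s => if s ≤ b then u₁ s else u₂ s :=
    Measurable.ite measurableSet_Iic h₁.1 h₂.1
  have huU : ∀ s ∈ Icc a c, (if s ≤ b then u₁ s else u₂ s) ∈ U := by
    intro s hs
    split_ifs with hsb
    · exact h₁.2.1 s ⟨hs.1, hsb⟩
    · exact h₂.2.1 s ⟨(not_le.1 hsb).le, hs.2⟩
  have hcont : ContinuousOn (fun s => if s ≤ b then γ₁ s else γ₂ s) (Icc a c) := by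
    rw [← Icc_union_Icc_eq_Icc hab hbc]
    exact (h₁.2.2.1.congr e₁).union_of_isClosed (h₂.2.2.1.congr e₂) isClosed_Icc isClosed_Icc
  refine ⟨hu, huU, hcont, fun s hs => ?_⟩
  rcases le_total s b with hsb | hbs
  · rw [i₁ s ⟨hs.1, hsb⟩, e₁ ⟨hs.1, hsb⟩, e₁ ⟨le_rfl, hab⟩]
    exact h₁.2.2.2 s ⟨hs.1, hsb⟩
  · have hint : IntervalIntegrable (fun r => f (if r ≤ b then γ₁ r else γ₂ r)
        (if r ≤ b then u₁ r else u₂ r)) volume a s :=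
      intervalIntegrable_comp_of_isCompact (G := fun x v _ => f x v)
        (hf.comp (continuous_fst.prodMk continuous_snd.fst)) hU hs.1 hu
        (fun r hr => huU r ⟨hr.1, hr.2.trans hs.2⟩)
        (hcont.mono (Icc_subset_Icc le_rfl hs.2))
    rw [← intervalIntegral.integral_add_adjacent_intervals (b := b)
      (hint.mono_set (by
        rw [uIcc_of_le hab, uIcc_of_le hs.1]; exact Icc_subset_Icc le_rfl hbs))
      (hint.mono_set (by
        rw [uIcc_of_le hbs, uIcc_of_le hs.1]; exact Icc_subset_Icc hab le_rfl)),
      i₁ b ⟨hab, le_rfl⟩, i₂ s ⟨hbs, hs.2⟩, e₁ ⟨le_rfl, hab⟩, e₂ ⟨hbs, hs.2⟩, ← add_assoc,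
      ← h₁.2.2.2 b ⟨hab, le_rfl⟩, hγ]
    exact h₂.2.2.2 s ⟨hbs, hs.2⟩

/-- Backward Grönwall bound for the initial point of an admissible trajectory. -/
lemma norm_left_le {K M : ℝ} (h : IsAdmissible f U a b u γ) (hab : a ≤ b) (hU : IsCompact U)
    (hf : Continuous fun p : En n × En m => f p.1 p.2) (hK : 0 ≤ K) (hM : 0 ≤ M)
    (hUM : ∀ v ∈ U, ‖v‖ ≤ M) (hA : ∀ x v, ‖f x v‖ ≤ K * (1 + ‖x‖ + ‖v‖)) :
    ‖γ a‖ ≤ Real.exp (K * (b - a)) * (1 + M + ‖γ b‖) := by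
  set γ' : ℝ → En n := IccExtend hab ((Icc a b).domRestrict γ) with hγ'
  have hγ'c : Continuous γ' := h.2.2.1.domRestrict.Icc_extend'
  have hγ'e : ∀ s ∈ Icc a b, γ' s = γ s := fun s hs => by
    rw [hγ', IccExtend_of_mem hab _ hs, domRestrict_apply]
  have hpc : Continuous fun r => K * (1 + M + ‖γ' r‖) := by fun_prop
  set g : ℝ → ℝ := fun s => ‖γ b‖ + ∫ r in s..b, K * (1 + M + ‖γ' r‖) with hg
  have hgd : ∀ s, HasDerivAt g (-(K * (1 + M + ‖γ' s‖))) s := fun s =>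
    (intervalIntegral.integral_hasDerivAt_left (hpc.intervalIntegrable _ _)
      hpc.stronglyMeasurable.stronglyMeasurableAtFilter hpc.continuousAt).const_add _
  have hγg : ∀ s ∈ Icc a b, ‖γ s‖ ≤ g s := by
    intro s hs
    have e := h.eq_add_integral hU hf hs.1 hs.2 le_rfl
    have e' : γ s = γ b - ∫ r in s..b, f (γ r) (u r) := by rw [e]; abel
    rw [e']
    refine (norm_sub_le _ _).trans (add_le_add le_rfl ?_)
    refine intervalIntegral.norm_integral_le_of_norm_le hs.2 ?_ (hpc.intervalIntegrable _ _)
    filter_upwards with r hr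
    have hr' : r ∈ Icc a b := ⟨hs.1.trans hr.1.le, hr.2⟩
    rw [hγ'e r hr']
    refine (hA _ _).trans (mul_le_mul_of_nonneg_left ?_ hK)
    linarith [hUM _ (h.2.1 r hr')]
  have hE : ∀ s, HasDerivAt (fun s => Real.exp (K * s) * (1 + M + g s))
      (Real.exp (K * s) * K * (1 + M + g s) +
        Real.exp (K * s) * (-(K * (1 + M + ‖γ' s‖)))) s := by
    intro s
    have h1 : HasDerivAt (fun s => Real.exp (K * s)) (Real.exp (K * s) * K) s := by
      simpa using ((hasDerivAt_id s).const_mul K).exp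
    exact h1.mul ((hgd s).const_add _)
  have hmono : MonotoneOn (fun s => Real.exp (K * s) * (1 + M + g s)) (Icc a b) := by
    refine monotoneOn_of_deriv_nonneg (convex_Icc a b)
      (fun s _ => (hE s).continuousAt.continuousWithinAt)
      (fun s _ => (hE s).differentiableAt.differentiableWithinAt) fun s hs => ?_
    have hs' := interior_subset hs
    rw [(hE s).deriv, hγ'e s hs']
    have := mul_nonneg (mul_nonneg (Real.exp_pos (K * s)).le hK) (sub_nonneg.2 (hγg s hs'))
    linarith
  have hfin := hmono ⟨le_rfl, hab⟩ ⟨hab, le_rfl⟩ hab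
  have hgb : g b = ‖γ b‖ := by simp [hg]
  simp only [hgb] at hfin
  have hexp : Real.exp (K * b) = Real.exp (K * a) * Real.exp (K * (b - a)) := by
    rw [← Real.exp_add]; ring_nf
  rw [hexp, mul_assoc] at hfin
  have := le_of_mul_le_mul_left hfin (Real.exp_pos _)
  linarith [hγg a ⟨le_rfl, hab⟩]

end IsAdmissible

lemma exists_isAdmissible_const_of_sub_le {K K' : ℝ} (hK : 0 < K) (hK' : 0 ≤ K')
    (hf : Continuous fun p : En n × En m => f p.1 p.2)
    (hA : ∀ x v, ‖f x v‖ ≤ K * (1 + ‖x‖ + ‖v‖))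
    (hLip : ∀ x₁ x₂ v, v ∈ U → ‖f x₂ v - f x₁ v‖ ≤ K' * ‖x₂ - x₁‖)
    {v : En m} (hv : v ∈ U) (hab : a ≤ b) (hsmall : b - a ≤ 1 / (2 * K)) (x : En n) :
    ∃ γ, IsAdmissible f U a b (fun _ => v) γ ∧ γ b = x := by
  have hR : 0 ≤ 1 + ‖x‖ + ‖v‖ := by positivity
  have hB : 0 ≤ 2 * K * (1 + ‖x‖ + ‖v‖) := by positivity
  have hPL : IsPicardLindelof (fun _ y => f y v) (⟨b, hab, le_rfl⟩ : Icc a b) x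
      ⟨1 + ‖x‖ + ‖v‖, hR⟩ 0 ⟨2 * K * (1 + ‖x‖ + ‖v‖), hB⟩ ⟨K', hK'⟩ := by
    refine ⟨fun _ _ => ?_, fun _ _ => continuousOn_const, fun _ _ y hy => ?_, ?_⟩
    · refine (LipschitzWith.of_dist_le_mul fun y z => ?_).lipschitzOnWith
      rw [dist_eq_norm, dist_eq_norm]
      exact hLip z y v hv
    · have h1 : ‖y‖ ≤ ‖x‖ + (1 + ‖x‖ + ‖v‖) := by
        have h2 : ‖y - x‖ ≤ 1 + ‖x‖ + ‖v‖ := by rw [← dist_eq_norm]; exact hy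
        linarith [norm_le_norm_add_norm_sub' y x]
      refine (hA y v).trans ?_
      change _ ≤ 2 * K * (1 + ‖x‖ + ‖v‖)
      nlinarith [norm_nonneg v]
    · change 2 * K * (1 + ‖x‖ + ‖v‖) * max (b - b) (b - a) ≤ (1 + ‖x‖ + ‖v‖) - 0
      rw [sub_self, max_eq_right (sub_nonneg.2 hab), sub_zero]
      have h1 : 2 * K * (b - a) ≤ 1 := by
        rw [le_div_iff₀ (by positivity)] at hsmall
        linarith
      nlinarith
  obtain ⟨γ, hγb, hγ⟩ := hPL.exists_eq_forall_mem_Icc_hasDerivWithinAt₀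
  have hγc : ContinuousOn γ (Icc a b) := fun s hs => (hγ s hs).continuousWithinAt
  have hfc : ContinuousOn (fun r => f (γ r) v) (Icc a b) :=
    hf.comp_continuousOn (hγc.prodMk continuousOn_const)
  refine ⟨γ, ⟨measurable_const, fun _ _ => hv, hγc, fun s hs => ?_⟩, hγb⟩
  have hsub : Icc a s ⊆ Icc a b := Icc_subset_Icc le_rfl hs.2
  rw [intervalIntegral.integral_eq_sub_of_hasDerivAt_of_le hs.1 (hγc.mono hsub)
    (fun r hr => (hγ r (hsub ⟨hr.1.le, hr.2.le⟩)).hasDerivAt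
      (Icc_mem_nhds hr.1 (hr.2.trans_le hs.2)))
    ((hfc.mono hsub).intervalIntegrable_of_Icc hs.1)]
  abel

lemma exists_isAdmissible_const {K K' : ℝ} (hU : IsCompact U) (hK : 0 < K) (hK' : 0 ≤ K')
    (hf : Continuous fun p : En n × En m => f p.1 p.2)
    (hA : ∀ x v, ‖f x v‖ ≤ K * (1 + ‖x‖ + ‖v‖))
    (hLip : ∀ x₁ x₂ v, v ∈ U → ‖f x₂ v - f x₁ v‖ ≤ K' * ‖x₂ - x₁‖)
    {v : En m} (hv : v ∈ U) (hab : a ≤ b) (x : En n) :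
    ∃ γ, IsAdmissible f U a b (fun _ => v) γ ∧ γ b = x := by
  have hh : 0 < 1 / (2 * K) := by positivity
  obtain ⟨k, hk⟩ := exists_nat_ge ((b - a) / (1 / (2 * K)))
  rw [div_le_iff₀ hh] at hk
  induction k generalizing b x with
  | zero =>
    exact exists_isAdmissible_const_of_sub_le hK hK' hf hA hLip hv hab
      (by simp only [Nat.cast_zero, zero_mul] at hk; linarith) x
  | succ k ih =>
    rcases le_total (b - a) (1 / (2 * K)) with hs | hs
    · exact exists_isAdmissible_const_of_sub_le hK hK' hf hA hLip hv hab hs x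
    · obtain ⟨γ₂, h₂, hγ₂⟩ := exists_isAdmissible_const_of_sub_le (a := b - 1 / (2 * K)) (b := b)
        hK hK' hf hA hLip hv (by linarith) (by linarith) x
      obtain ⟨γ₁, h₁, hγ₁⟩ := ih (b := b - 1 / (2 * K)) (by linarith)
        (γ₂ (b - 1 / (2 * K))) (by push_cast at hk; linarith)
      have hc := h₁.concat h₂ hU hf (by linarith) (by linarith) hγ₁
      simp only [ite_self] at hc
      exact ⟨_, hc, by rw [if_neg (by linarith), hγ₂]⟩

end AdmissiblePairs

section ValueFunction

variable {n m : ℕ} {f : En n → En m → En n} {U : Set (En m)} {L : En n → En m → ℝ → ℝ}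
  {I : En n → ℝ} {T t : ℝ}

lemma bddBelow_bolzaCosts {K : ℝ} (hU : IsCompact U) (hK : 0 ≤ K)
    (hf : Continuous fun p : En n × En m => f p.1 p.2)
    (hA : ∀ x v, ‖f x v‖ ≤ K * (1 + ‖x‖ + ‖v‖))
    (hL : Continuous fun p : En n × En m × ℝ => L p.1 p.2.1 p.2.2)
    (hLb : ∃ C : ℝ, ∀ x v s, v ∈ U → s ∈ Icc (0 : ℝ) T → -C ≤ L x v s)
    (hI : Continuous I) (ht : t ∈ Icc 0 T) (x : En n) :
    BddBelow { J | ∃ u γ, IsAdmissible f U 0 t u γ ∧ γ t = x ∧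
      J = (∫ s in (0:ℝ)..t, L (γ s) (u s) s) + I (γ 0) } := by
  obtain ⟨C, hC⟩ := hLb
  obtain ⟨M, hM⟩ := hU.isBounded.exists_norm_le
  obtain ⟨B, hB⟩ := (isCompact_closedBall (0 : En n)
    (Real.exp (K * (t - 0)) * (1 + max M 0 + ‖x‖))).exists_bound_of_continuousOn hI.continuousOn
  refine ⟨(t - 0) * (-C) + -B, ?_⟩
  rintro J ⟨u, γ, h, rfl, rfl⟩
  refine add_le_add ?_ ?_
  · have := intervalIntegral.integral_mono_on ht.1 (intervalIntegrable_const (c := -C))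
      (h.intervalIntegrable ht.1 hU hL) fun s hs => hC _ _ s (h.2.1 s hs) ⟨hs.1, hs.2.trans ht.2⟩
    simpa using this
  · refine neg_le_of_abs_le (hB _ ?_)
    rw [mem_closedBall_zero_iff]
    exact h.norm_left_le ht.1 hU hf hK (le_max_right _ _)
      (fun v hv => (hM v hv).trans (le_max_left _ _)) hA

/-- One half of the dynamic programming principle. -/
lemma valueFun_le_valueFun_add_integral {K : ℝ} (hU : IsCompact U) (hK : 0 ≤ K)
    (hf : Continuous fun p : En n × En m => f p.1 p.2)
    (hA : ∀ x v, ‖f x v‖ ≤ K * (1 + ‖x‖ + ‖v‖))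
    (hL : Continuous fun p : En n × En m × ℝ => L p.1 p.2.1 p.2.2)
    (hLb : ∃ C : ℝ, ∀ x v s, v ∈ U → s ∈ Icc (0 : ℝ) T → -C ≤ L x v s)
    (hI : Continuous I) (ht : t ∈ Icc 0 T) {u : ℝ → En m} {γ : ℝ → En n}
    (h : IsAdmissible f U 0 t u γ) {s : ℝ} (hs : s ∈ Icc 0 t) :
    valueFun f U L I t (γ t) ≤
      valueFun f U L I s (γ s) + ∫ r in s..t, L (γ r) (u r) r := by
  rw [← sub_le_iff_le_add]
  refine le_csInf ⟨_, u, γ, h.restrict hU hf le_rfl hs.2, rfl, rfl⟩ ?_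
  rintro J ⟨u₁, γ₁, h₁, hγ₁, rfl⟩
  rw [sub_le_iff_le_add]
  have hc := h₁.concat (h.restrict hU hf hs.1 le_rfl) hU hf hs.1 hs.2 hγ₁
  refine csInf_le (bddBelow_bolzaCosts hU hK hf hA hL hLb hI ht (γ t)) ⟨_, _, hc, ?_, ?_⟩
  · split_ifs with hts
    · rw [le_antisymm hts hs.2, hγ₁]
    · rfl
  · have hint := hc.intervalIntegrable ht.1 hU hL
    rw [← intervalIntegral.integral_add_adjacent_intervals (b := s)
      (hint.mono_set (by
        rw [uIcc_of_le hs.1, uIcc_of_le ht.1]; exact Icc_subset_Icc le_rfl hs.2))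
      (hint.mono_set (by
        rw [uIcc_of_le hs.2, uIcc_of_le ht.1]; exact Icc_subset_Icc hs.1 le_rfl)),
      intervalIntegral_congr_Ioc (g := fun r => L (if r ≤ s then γ₁ r else γ r)
        (if r ≤ s then u₁ r else u r) r) (h := fun r => L (γ₁ r) (u₁ r) r) hs.1
        (fun r hr => by simp [hr.2]),
      intervalIntegral_congr_Ioc (g := fun r => L (if r ≤ s then γ₁ r else γ r)
        (if r ≤ s then u₁ r else u r) r) (h := fun r => L (γ r) (u r) r) hs.2
        (fun r hr => by simp [not_le.2 hr.1]), if_pos hs.1]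
    ring

end ValueFunction

lemma HasDerivWithinAt.nonpos_of_eventually_le {w : ℝ → ℝ} {w' a : ℝ}
    (hw : HasDerivWithinAt w w' (Iio a) a) (h : ∀ᶠ s in nhdsWithin a (Iio a), w a ≤ w s) :
    w' ≤ 0 := by
  rw [hasDerivWithinAt_iff_tendsto_slope' (by simp)] at hw
  refine le_of_tendsto hw ?_
  filter_upwards [h, self_mem_nhdsWithin] with s hs hsa
  rw [slope_def_field]
  exact div_nonpos_of_nonneg_of_nonpos (sub_nonneg.2 hs) (sub_nonpos.2 (le_of_lt hsa))

/-- The value function is a viscosity subsolution of the HJB equation. -/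
theorem value_function_viscosity_subsolution {n m : ℕ} (T : ℝ) (hT : 0 < T)
    (U : Set (En m)) (hU : IsCompact U) (hUne : U.Nonempty)
    (f : En n → En m → En n)
    (hf : Continuous fun p : En n × En m => f p.1 p.2)
    (K₀ : ℝ) (hK₀ : 0 < K₀)
    (hA1 : ∀ x u, ‖f x u‖ ≤ K₀ * (1 + ‖x‖ + ‖u‖))
    (K₁ : ℝ) (hK₁ : 0 < K₁)
    (hA2 : ∀ x₁ x₂ u, u ∈ U → ‖f x₂ u - f x₁ u‖ ≤ K₁ * ‖x₂ - x₁‖)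
    (L : En n → En m → ℝ → ℝ)
    (hL : Continuous fun p : En n × En m × ℝ => L p.1 p.2.1 p.2.2)
    (hL1 : ∀ K : ℝ, ∃ C : ℝ, ∀ x u t, u ∈ U → t ∈ Icc (0:ℝ) T →
      K * ‖u‖ - C ≤ L x u t)
    (hL2 : ∀ R > (0:ℝ), ∃ α : ℝ, ∀ x₁ x₂ u t, ‖x₁‖ ≤ R → ‖x₂‖ ≤ R → u ∈ U →
      t ∈ Icc (0:ℝ) T → |L x₂ u t - L x₁ u t| ≤ α * ‖x₂ - x₁‖)
    (hLu : ∃ C : ℝ, ∀ x u₁ u₂ t, u₁ ∈ U → u₂ ∈ U → t ∈ Icc (0:ℝ) T →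
      |L x u₁ t - L x u₂ t| ≤ C * ‖u₁ - u₂‖)
    (I : En n → ℝ) (hI : Continuous I)
    (φ : ℝ → En n → ℝ) (hφ : ContDiff ℝ 1 fun p : ℝ × En n => φ p.1 p.2)
    (t₀ : ℝ) (x₀ : En n) (ht₀ : t₀ ∈ Ioo 0 T)
    (hmax : IsLocalMax (fun p : ℝ × En n =>
      valueFun f U L I p.1 p.2 - φ p.1 p.2) (t₀, x₀)) :
    deriv (fun τ => φ τ x₀) t₀ + ham f U L x₀ (gradient (φ t₀) x₀) t₀ ≤ 0 := by
  have hφd : HasFDerivAt (fun p : ℝ × En n => φ p.1 p.2)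
      (fderiv ℝ (fun p : ℝ × En n => φ p.1 p.2) (t₀, x₀)) (t₀, x₀) :=
    (hφ.differentiable one_ne_zero (t₀, x₀)).hasFDerivAt
  set D := fderiv ℝ (fun p : ℝ × En n => φ p.1 p.2) (t₀, x₀)
  have hDt : deriv (fun τ => φ τ x₀) t₀ = D (1, 0) := by
    have h1 : HasDerivAt (fun τ : ℝ => (τ, x₀)) ((1 : ℝ), (0 : En n)) t₀ :=
      (hasDerivAt_id t₀).prodMk (hasDerivAt_const t₀ x₀)
    exact (hφd.comp_hasDerivAt t₀ h1).deriv
  have hDx : ∀ y : En n, ⟪gradient (φ t₀) x₀, y⟫ = D (0, y) := by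
    intro y
    have h1 : HasFDerivAt (fun x : En n => (t₀, x)) (ContinuousLinearMap.inr ℝ ℝ (En n)) x₀ :=
      hasFDerivAt_prodMk_right t₀ x₀
    have h2 : HasFDerivAt (φ t₀) (D.comp (ContinuousLinearMap.inr ℝ ℝ (En n))) x₀ :=
      hφd.comp x₀ h1
    rw [gradient, h2.fderiv, InnerProductSpace.toDual_symm_apply]
    simp
  obtain ⟨C, hC⟩ := hL1 0
  have hLb : ∃ C : ℝ, ∀ x v s, v ∈ U → s ∈ Icc (0 : ℝ) T → -C ≤ L x v s :=
    ⟨C, fun x v s hv hs => by simpa using hC x v s hv hs⟩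
  rw [← le_neg_iff_add_nonpos_left]
  obtain ⟨v₀, hv₀⟩ := hUne
  refine csSup_le ⟨_, v₀, hv₀, rfl⟩ ?_
  rintro _ ⟨v, hv, rfl⟩
  rw [hDt, hDx]
  obtain ⟨γ, hγ, hγt⟩ := exists_isAdmissible_const (a := 0) (b := t₀) hU hK₀ hK₁.le hf hA1 hA2 hv
    ht₀.1.le x₀
  set η : ℝ → En n := IccExtend ht₀.1.le ((Icc 0 t₀).domRestrict γ) with hη
  have hηc : Continuous η := hγ.2.2.1.domRestrict.Icc_extend'
  have hηe : ∀ s ∈ Icc 0 t₀, η s = γ s := fun s hs => by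
    rw [hη, IccExtend_of_mem _ _ hs, domRestrict_apply]
  have hηt : η t₀ = x₀ := by rw [hηe t₀ ⟨ht₀.1.le, le_rfl⟩, hγt]
  have hfc : Continuous fun r => f (η r) v := hf.comp (hηc.prodMk continuous_const)
  have hLc : Continuous fun r => L (η r) v r :=
    hL.comp (hηc.prodMk (continuous_const.prodMk continuous_id))
  have hγd : HasDerivWithinAt γ (f x₀ v) (Iio t₀) t₀ := by
    have h1 : HasDerivAt (fun s => γ 0 + ∫ r in (0 : ℝ)..s, f (η r) v) (f (η t₀) v) t₀ :=
      (hfc.integral_hasStrictDerivAt 0 t₀).hasDerivAt.const_add _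
    rw [hηt] at h1
    have h2 : ∀ s ∈ Icc 0 t₀, γ s = γ 0 + ∫ r in (0 : ℝ)..s, f (η r) v := fun s hs => by
      rw [hγ.2.2.2 s hs]
      congr 1
      exact intervalIntegral_congr_Ioc hs.1 fun r hr => by
        simp only [hηe r ⟨hr.1.le, hr.2.trans hs.2⟩]
    refine h1.hasDerivWithinAt.congr_of_eventuallyEq ?_ (h2 t₀ ⟨ht₀.1.le, le_rfl⟩)
    filter_upwards [Ioo_mem_nhdsLT ht₀.1] with s hs
    exact h2 s ⟨hs.1.le, hs.2.le⟩
  have hpath : HasDerivWithinAt (fun s => (s, γ s)) ((1 : ℝ), f x₀ v) (Iio t₀) t₀ :=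
    (hasDerivWithinAt_id t₀ _).prodMk hγd
  have hφγ : HasDerivWithinAt (fun s => φ s (γ s)) (D (1, f x₀ v)) (Iio t₀) t₀ := by
    have hφd' : HasFDerivAt (fun p : ℝ × En n => φ p.1 p.2) D (t₀, γ t₀) := by rwa [hγt]
    exact hφd'.comp_hasDerivWithinAt t₀ hpath
  have hΛ : HasDerivAt (fun s => ∫ r in (0 : ℝ)..s, L (η r) v r) (L x₀ v t₀) t₀ := by
    simpa only [hηt] using (hLc.integral_hasStrictDerivAt 0 t₀).hasDerivAt
  have hw := (hφγ.sub hΛ.hasDerivWithinAt).nonpos_of_eventually_le (by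
    have htend : Filter.Tendsto (fun s => (s, γ s)) (nhdsWithin t₀ (Iio t₀))
        (nhds (t₀, x₀)) := by
      have := hpath.continuousWithinAt.tendsto
      rwa [hγt] at this
    filter_upwards [htend.eventually hmax, Ioo_mem_nhdsLT ht₀.1] with s hs hs0
    have hs' : s ∈ Icc 0 t₀ := ⟨hs0.1.le, hs0.2.le⟩
    have hdp := valueFun_le_valueFun_add_integral hU hK₀.le hf hA1 hL hLb hI
      ⟨ht₀.1.le, ht₀.2.le⟩ hγ hs'
    have hcongr : ∫ r in s..t₀, L (γ r) v r = ∫ r in s..t₀, L (η r) v r :=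
      intervalIntegral_congr_Ioc hs'.2 fun r hr => by
        simp only [hηe r ⟨hs0.1.le.trans hr.1.le, hr.2⟩]
    have hadd := intervalIntegral.integral_add_adjacent_intervals
      (hLc.intervalIntegrable (μ := volume) 0 s) (hLc.intervalIntegrable (μ := volume) s t₀)
    rw [hcongr, hγt] at hdp
    simp only [Pi.sub_apply, hγt]
    linarith)
  have hsplit : D (1, f x₀ v) = D (1, 0) + D (0, f x₀ v) := by
    rw [← map_add]; simp
  linarith
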